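/- arXiv:2203.14598 — 3 statements merged into one kernel-verified Lean document; each statement's English description precedes it below -/
import Mathlib

section
/- Let Γ = ⟨S_Γ⟩ be a finitely generated group and Λ ≤ Γ a finite index subgroup. Let m_Λ and m_Γ be the Haar probability measures on Iso(Γ)/Λ and Iso(Γ)/Γ respectively, and let u be the uniform probability measure on Γ/Λ. Then the p.m.p. action Γ ↷ (Iso(Γ)/Λ, m_Λ) is isometric orbit equivalent to the diagonal action Γ ↷ (Iso(Γ)/Γ × Γ/Λ, m_Γ ⊗ u). -/
open MeasureTheory

namespace IOE

/-- Word length of a group element with respect to a set `S`, valued in `ℕ∞`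
(`⊤` if the element is not a product of elements of `S`). -/
noncomputable def wlen {G : Type*} [Group G] (S : Set G) (g : G) : ℕ∞ :=
  sInf {n : ℕ∞ | ∃ l : List G, (∀ s ∈ l, s ∈ S) ∧ l.prod = g ∧ (l.length : ℕ∞) = n}

/-- A generating system: a symmetric generating set not containing the identity. -/
structure IsGenSystem {G : Type*} [Group G] (S : Set G) : Prop where
  inv_mem : ∀ s ∈ S, s⁻¹ ∈ S
  one_not_mem : (1 : G) ∉ S
  closure_eq_top : Subgroup.closure S = ⊤

/-- A finite generating system. -/
structure IsFinGenSystem {G : Type*} [Group G] (S : Set G) extends IsGenSystem S : Prop where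
  finite : S.Finite

/-- The extended graph metric on `X` associated with an action `act` of `G` on `X`
and a set `S ⊆ G`: the length of a shortest `S`-path from `x` to `y`. -/
noncomputable def gdist {G X : Type*} (act : G → X → X) (S : Set G) (x y : X) : ℕ∞ :=
  sInf {n : ℕ∞ | ∃ l : List G, (∀ s ∈ l, s ∈ S) ∧ l.foldr act x = y ∧ (l.length : ℕ∞) = n}

/-- A set is saturated if it is a union of connected components of the graphing. -/
def Saturated {G X : Type*} (act : G → X → X) (S : Set G) (A : Set X) : Prop :=
  ∀ x ∈ A, ∀ y : X, gdist act S x y ≠ ⊤ → y ∈ A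

/-- `act` is a probability-measure-preserving action of `G` on `(X, μ)`. -/
structure IsPmpAction {G X : Type*} [Group G] [MeasurableSpace X]
    (act : G → X → X) (μ : Measure X) : Prop where
  one_act : ∀ x, act 1 x = x
  mul_act : ∀ g h x, act (g * h) x = act g (act h x)
  measurePreserving : ∀ g, MeasurePreserving (act g) μ μ

/-- An action is essentially free if almost every point has trivial stabilizer. -/
def EssentiallyFree {G X : Type*} [Group G] [MeasurableSpace X]
    (act : G → X → X) (μ : Measure X) : Prop :=
  ∀ᵐ x ∂μ, ∀ g : G, act g x = x → g = 1

/-- Two actions are isometric orbit equivalent: there is a measure-preserving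
bimeasurable bijection which is an isometry between the graphings, on a saturated
conull set. -/
def IsomOrbitEquiv {G H X Y : Type*} [MeasurableSpace X] [MeasurableSpace Y]
    (actA : G → X → X) (SG : Set G) (μ : Measure X)
    (actB : H → Y → Y) (SH : Set H) (ν : Measure Y) : Prop :=
  ∃ Φ : X ≃ Y, Measurable Φ ∧ Measurable Φ.symm ∧ MeasurePreserving Φ μ ν ∧
    ∃ X₀ : Set X, μ X₀ᶜ = 0 ∧ Saturated actA SG X₀ ∧ Saturated actB SH (Φ '' X₀) ∧
      ∀ x ∈ X₀, ∀ x' ∈ X₀, gdist actB SH (Φ x) (Φ x') = gdist actA SG x x'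

/-- A measurable cocycle `σ : G × X → H` for the action `act` of `G` on `(X, μ)`. -/
def IsCocycle {G H X : Type*} [Group G] [Group H] [MeasurableSpace X]
    (act : G → X → X) (μ : Measure X) (σ : G → X → H) : Prop :=
  (∀ (g : G) (h : H), MeasurableSet {x | σ g x = h}) ∧
  ∀ g h : G, ∀ᵐ x ∂μ, σ (g * h) x = σ g (act h x) * σ h x

/-- A cocycle is length-preserving if it preserves the word lengths almost surely. -/
def LengthPreservingCocycle {G H X : Type*} [Group G] [Group H] [MeasurableSpace X]
    (SG : Set G) (SH : Set H) (μ : Measure X) (σ : G → X → H) : Prop :=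
  ∀ g : G, ∀ᵐ x ∂μ, wlen SH (σ g x) = wlen SG g

end IOE
namespace IOE

variable {Γ Λ Ξ : Type*} [Group Γ] [Group Λ] [Group Ξ]

/-- A bijective isometry between the Cayley graphs `(Γ, S)` and `(Λ, T)`. -/
structure CayleyIso (S : Set Γ) (T : Set Λ) where
  toEquiv : Γ ≃ Λ
  isom : ∀ a b : Γ, wlen T ((toEquiv a)⁻¹ * toEquiv b) = wlen S (a⁻¹ * b)

namespace CayleyIso

variable {S : Set Γ} {T : Set Λ} {U : Set Ξ}

@[ext] theorem ext {f g : CayleyIso S T} (h : ∀ x, f.toEquiv x = g.toEquiv x) : f = g := by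
  cases f; cases g
  simp only [mk.injEq]
  exact Equiv.ext h

/-- Composition of Cayley isometries (`comp g f` applies `f` first). -/
def comp (g : CayleyIso T U) (f : CayleyIso S T) : CayleyIso S U where
  toEquiv := f.toEquiv.trans g.toEquiv
  isom := fun a b => by
    simpa [Equiv.trans_apply] using (g.isom (f.toEquiv a) (f.toEquiv b)).trans (f.isom a b)

/-- The inverse of a Cayley isometry. -/
def inv (f : CayleyIso S T) : CayleyIso T S where
  toEquiv := f.toEquiv.symm
  isom := fun a b => by
    simpa using (f.isom (f.toEquiv.symm a) (f.toEquiv.symm b)).symm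

/-- The identity Cayley isometry. -/
def refl (S : Set Γ) : CayleyIso S S := ⟨Equiv.refl Γ, fun _ _ => rfl⟩

/-- The group `Iso(Γ)` of bijective isometries of the Cayley graph `(Γ, S)`,
under composition. -/
instance : Group (CayleyIso S S) where
  mul f g := comp f g
  one := refl S
  inv := inv
  mul_assoc f g h := ext fun x => rfl
  one_mul f := ext fun x => rfl
  mul_one f := ext fun x => rfl
  inv_mul_cancel f := ext fun x => f.toEquiv.symm_apply_apply x

@[simp] theorem mul_apply (f g : CayleyIso S S) (x : Γ) :
    (f * g).toEquiv x = f.toEquiv (g.toEquiv x) := rfl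

@[simp] theorem one_apply (x : Γ) : (1 : CayleyIso S S).toEquiv x = x := rfl

@[simp] theorem inv_apply (f : CayleyIso S S) (x : Γ) :
    (f⁻¹).toEquiv x = f.toEquiv.symm x := rfl

/-- Left multiplication by a group element, as a Cayley isometry. -/
def leftMult (S : Set Γ) (γ : Γ) : CayleyIso S S where
  toEquiv := Equiv.mulLeft γ
  isom := fun a b => by
    simp only [Equiv.coe_mulLeft]
    congr 1
    group

@[simp] theorem leftMult_apply (γ x : Γ) : (leftMult S γ).toEquiv x = γ * x := rfl

/-- Post-composition by left multiplication. -/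
def lsmul (lam : Λ) (f : CayleyIso S T) : CayleyIso S T where
  toEquiv := f.toEquiv.trans (Equiv.mulLeft lam)
  isom := fun a b => by
    simp only [Equiv.trans_apply, Equiv.coe_mulLeft]
    rw [show (lam * f.toEquiv a)⁻¹ * (lam * f.toEquiv b)
        = (f.toEquiv a)⁻¹ * f.toEquiv b by group, f.isom]

@[simp] theorem lsmul_apply (lam : Λ) (f : CayleyIso S T) (x : Γ) :
    (lsmul lam f).toEquiv x = lam * f.toEquiv x := rfl

/-- The action of `Λ` on `Iso(Γ,Λ)` by post-composition. -/
instance : MulAction Λ (CayleyIso S T) where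
  smul := lsmul
  one_smul f := ext fun x => one_mul _
  mul_smul a b f := ext fun x => mul_assoc a b _

@[simp] theorem smul_apply (lam : Λ) (f : CayleyIso S T) (x : Γ) :
    (lam • f).toEquiv x = lam * f.toEquiv x := rfl

/-- The σ-algebra of pointwise convergence on `Iso(Γ,Λ)`. -/
instance : MeasurableSpace (CayleyIso S T) :=
  MeasurableSpace.comap (fun f (γ : Γ) => f.toEquiv γ)
    (@MeasurableSpace.pi Γ (fun _ => Λ) (fun _ => ⊤))

/-- The topology of pointwise convergence on `Iso(Γ,Λ)`. -/
instance : TopologicalSpace (CayleyIso S T) :=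
  TopologicalSpace.induced (fun f (γ : Γ) => f.toEquiv γ)
    (@Pi.topologicalSpace Γ (fun _ => Λ) (fun _ => ⊥))

end CayleyIso

/-- `Iso₁(Γ,Λ)`: the bijective isometries between the Cayley graphs sending `1` to `1`. -/
def Iso1 {Γ Λ : Type*} [Group Γ] [Group Λ] (S : Set Γ) (T : Set Λ) : Type _ :=
  {f : CayleyIso S T // f.toEquiv 1 = 1}

namespace Iso1

variable {S : Set Γ} {T : Set Λ}

instance : MeasurableSpace (Iso1 S T) := by unfold Iso1; infer_instance
instance : TopologicalSpace (Iso1 S T) := by unfold Iso1; infer_instance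

/-- The natural action of `Γ` on `Iso₁(Γ,Λ)`: `(γ · f)(δ) = f(γ⁻¹)⁻¹ f(γ⁻¹δ)`. -/
def natAct (γ : Γ) (f : Iso1 S T) : Iso1 S T :=
  ⟨CayleyIso.lsmul (f.1.toEquiv γ⁻¹)⁻¹ (CayleyIso.comp f.1 (CayleyIso.leftMult S γ⁻¹)), by
    show (f.1.toEquiv γ⁻¹)⁻¹ * f.1.toEquiv (γ⁻¹ * 1) = 1
    rw [mul_one, inv_mul_cancel]⟩

@[simp] theorem natAct_apply (γ : Γ) (f : Iso1 S T) (δ : Γ) :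
    (natAct γ f).1.toEquiv δ = (f.1.toEquiv γ⁻¹)⁻¹ * f.1.toEquiv (γ⁻¹ * δ) := rfl

/-- Pre-composition by an element of `Iso₁(Γ)`. -/
def pre1 (h : Iso1 S S) (f : Iso1 S T) : Iso1 S T :=
  ⟨CayleyIso.comp f.1 h.1, by show f.1.toEquiv (h.1.toEquiv 1) = 1; rw [h.2, f.2]⟩

/-- Post-composition by an element of `Iso₁(Λ)`. -/
def post1 (k : Iso1 T T) (f : Iso1 S T) : Iso1 S T :=
  ⟨CayleyIso.comp k.1 f.1, by show k.1.toEquiv (f.1.toEquiv 1) = 1; rw [f.2, k.2]⟩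

/-- The inverse map `Iso₁(Γ,Λ) → Iso₁(Λ,Γ)`. -/
def inv1 (f : Iso1 S T) : Iso1 T S :=
  ⟨f.1.inv, by
    show f.1.toEquiv.symm 1 = 1
    exact (Equiv.symm_apply_eq _).mpr f.2.symm⟩

/-- The inverse map, as a bijection `Iso₁(Γ,Λ) ≃ Iso₁(Λ,Γ)`. -/
def invEquiv1 : Iso1 S T ≃ Iso1 T S where
  toFun := inv1
  invFun := inv1
  left_inv f := Subtype.ext (CayleyIso.ext fun x => by simp [inv1, CayleyIso.inv])
  right_inv f := Subtype.ext (CayleyIso.ext fun x => by simp [inv1, CayleyIso.inv])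

end Iso1

end IOE
namespace IOE

variable {Γ Λ : Type*} [Group Γ] [Group Λ]

/-- The action of `Iso(Γ)` on `Iso(Γ,Λ)` by pre-composition by the inverse,
descended to the quotient `Iso(Γ,Λ)/Λ` of `Iso(Γ,Λ)` by the post-composition
action of `Λ`. -/
def preQ {S : Set Γ} {T : Set Λ} (g : CayleyIso S S) :
    Quotient (MulAction.orbitRel Λ (CayleyIso S T)) →
      Quotient (MulAction.orbitRel Λ (CayleyIso S T)) :=
  Quotient.map (fun f => CayleyIso.comp f g⁻¹) (by
    intro a b hab
    obtain ⟨lam, rfl⟩ := hab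
    exact ⟨lam, CayleyIso.ext fun x => rfl⟩)

end IOE
namespace IOE

variable {Γ : Type*} [Group Γ]

/-- The action of `Iso(Γ)` on itself by pre-composition by the inverse (i.e. right
translation), descended to the quotient `Iso(Γ)/Λ` of `Iso(Γ)` by the post-composition
action of a subgroup `Λ ≤ Γ`. -/
def subQ {S : Set Γ} (Λ : Subgroup Γ) (g : CayleyIso S S) :
    Quotient (MulAction.orbitRel ↥Λ (CayleyIso S S)) →
      Quotient (MulAction.orbitRel ↥Λ (CayleyIso S S)) :=
  Quotient.map (fun f => f * g⁻¹) (by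
    intro a b hab
    obtain ⟨l, rfl⟩ := hab
    exact ⟨l, CayleyIso.ext fun x => rfl⟩)

/-- The natural action of `Iso(Γ)` on `Iso₁(Γ)`: `(g · f)(δ) = f(g⁻¹(1))⁻¹ f(g⁻¹(δ))`. -/
def natActIso {S : Set Γ} (g : CayleyIso S S) (f : Iso1 S S) : Iso1 S S :=
  ⟨CayleyIso.lsmul (f.1.toEquiv (g.toEquiv.symm 1))⁻¹ (f.1 * g⁻¹), by
    show (f.1.toEquiv (g.toEquiv.symm 1))⁻¹ * (f.1 * g⁻¹).toEquiv 1 = 1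
    exact inv_mul_cancel _⟩

end IOE

open MeasureTheory IOE

namespace IOE

section GraphDistance

variable {G H X Y : Type*}

theorem foldr_transport {actA : G → X → X} {actB : H → Y → Y} {S : Set G} {T : Set H}
    {Φ : X → Y} (h : ∀ x, ∀ s ∈ S, ∃ t ∈ T, Φ (actA s x) = actB t (Φ x)) (x : X) (l : List G)
    (hl : ∀ s ∈ l, s ∈ S) :
    ∃ l' : List H, (∀ t ∈ l', t ∈ T) ∧ l'.foldr actB (Φ x) = Φ (l.foldr actA x) ∧
      l'.length = l.length := by
  induction l with
  | nil => exact ⟨[], by simp, rfl, rfl⟩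
  | cons a l ih =>
    obtain ⟨l', h₁, h₂, h₃⟩ := ih fun s hs => hl s (List.mem_cons_of_mem _ hs)
    obtain ⟨t, ht, hat⟩ := h (l.foldr actA x) a (hl a List.mem_cons_self)
    refine ⟨t :: l', ?_, ?_, by simp [h₃]⟩
    · simpa using ⟨ht, h₁⟩
    · simp [h₂, hat]

theorem gdist_le_of_edge_map {actA : G → X → X} {actB : H → Y → Y} {S : Set G} {T : Set H}
    {Φ : X → Y} (h : ∀ x, ∀ s ∈ S, ∃ t ∈ T, Φ (actA s x) = actB t (Φ x)) (x x' : X) :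
    gdist actB T (Φ x) (Φ x') ≤ gdist actA S x x' := by
  refine le_sInf ?_
  rintro n ⟨l, hl, rfl, rfl⟩
  obtain ⟨l', h₁, h₂, h₃⟩ := foldr_transport h x l hl
  exact sInf_le ⟨l', h₁, h₂, by rw [h₃]⟩

/-- A bijection mapping edges to edges in both directions preserves the graph metrics. -/
theorem gdist_eq_of_edge_equiv {actA : G → X → X} {actB : H → Y → Y} {S : Set G} {T : Set H}
    (Φ : X ≃ Y) (h : ∀ x, ∀ s ∈ S, ∃ t ∈ T, Φ (actA s x) = actB t (Φ x))
    (h' : ∀ x, ∀ t ∈ T, ∃ s ∈ S, Φ (actA s x) = actB t (Φ x)) (x x' : X) :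
    gdist actB T (Φ x) (Φ x') = gdist actA S x x' := by
  refine le_antisymm (gdist_le_of_edge_map h x x') ?_
  have := gdist_le_of_edge_map (actA := actB) (actB := actA) (S := T) (T := S) (Φ := Φ.symm)
    (fun y t ht => ?_) (Φ x) (Φ x')
  · simpa using this
  · obtain ⟨s, hs, hst⟩ := h' (Φ.symm y) t ht
    exact ⟨s, hs, by rw [Equiv.symm_apply_eq, hst, Equiv.apply_symm_apply]⟩

theorem isomOrbitEquiv_of_edge_equiv [MeasurableSpace X] [MeasurableSpace Y]
    {actA : G → X → X} {actB : H → Y → Y} {S : Set G} {T : Set H} {μ : Measure X} {ν : Measure Y}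
    (Φ : X ≃ᵐ Y) (hΦ : MeasurePreserving Φ μ ν)
    (h : ∀ x, ∀ s ∈ S, ∃ t ∈ T, Φ (actA s x) = actB t (Φ x))
    (h' : ∀ x, ∀ t ∈ T, ∃ s ∈ S, Φ (actA s x) = actB t (Φ x)) :
    IsomOrbitEquiv actA S μ actB T ν := by
  refine ⟨Φ.toEquiv, Φ.measurable, Φ.symm.measurable, hΦ, Set.univ, by simp,
    fun _ _ _ _ => Set.mem_univ _, ?_, fun x _ x' _ => gdist_eq_of_edge_equiv Φ.toEquiv h h' x x'⟩
  intro _ _ y _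
  exact ⟨Φ.symm y, Set.mem_univ _, Φ.apply_symm_apply y⟩

end GraphDistance

section InvariantMeasures

variable {K : Type*} [Group K] [MeasurableSpace K] [MeasurableMul₂ K]

/-- A finite right invariant measure is proportional to any left invariant probability measure. -/
theorem eq_smul_of_rightInvariant_of_leftInvariant (μ ν : Measure K) [IsFiniteMeasure μ]
    [IsProbabilityMeasure ν] [μ.IsMulRightInvariant] [ν.IsMulLeftInvariant] :
    μ = μ Set.univ • ν := by
  ext A hA
  have hm : Measurable fun p : K × K => A.indicator (fun _ => (1 : ENNReal)) (p.1 * p.2) :=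
    (measurable_const.indicator hA).comp measurable_mul
  have h := lintegral_lintegral_swap (μ := μ) (ν := ν)
    (f := fun x y => A.indicator (fun _ => (1 : ENNReal)) (x * y)) hm.aemeasurable
  have h₁ (x : K) : ∫⁻ y, A.indicator (fun _ => (1 : ENNReal)) (x * y) ∂ν = ν A := by
    rw [lintegral_mul_left_eq_self (fun y => A.indicator (fun _ => (1 : ENNReal)) y) x,
      lintegral_indicator_const hA, one_mul]
  have h₂ (y : K) : ∫⁻ x, A.indicator (fun _ => (1 : ENNReal)) (x * y) ∂μ = μ A := by
    rw [lintegral_mul_right_eq_self (fun y => A.indicator (fun _ => (1 : ENNReal)) y) y,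
      lintegral_indicator_const hA, one_mul]
  simp only [h₁, h₂, lintegral_const, measure_univ, mul_one] at h
  rw [Measure.smul_apply, smul_eq_mul, mul_comm, h]

theorem inv_eq_self_of_rightInvariant [MeasurableInv K] (μ : Measure K) [IsProbabilityMeasure μ]
    [μ.IsMulRightInvariant] : μ.inv = μ := by
  have : IsProbabilityMeasure μ.inv := Measure.isProbabilityMeasure_map measurable_inv.aemeasurable
  simpa using (eq_smul_of_rightInvariant_of_leftInvariant μ μ.inv).symm

end InvariantMeasures

/-- If a weighted average attains the maximum of the averaged values, then every value with nonzero
weight is maximal. -/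
theorem eq_of_weighted_average {Q : Type*} [Fintype Q] {c p : Q → ENNReal} {M : ENNReal}
    (hp : ∑ q, p q = 1) (hM : M ≠ ⊤) (hc : ∀ q, c q ≤ M) (h : ∑ q, c q * p q = M) {q : Q}
    (hq : p q ≠ 0) : c q = M := by
  have hsum : M + ∑ q, (M - c q) * p q = M := by
    nth_rewrite 1 [← h]
    rw [← Finset.sum_add_distrib]
    simp_rw [← add_mul, add_tsub_cancel_of_le (hc _), ← Finset.mul_sum, hp, mul_one]
  have h0 : ∑ q, (M - c q) * p q = 0 := by
    rw [← ENNReal.add_right_inj hM, hsum, add_zero]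
  have := (mul_eq_zero.mp (Finset.sum_eq_zero_iff.mp h0 q (Finset.mem_univ q))).resolve_right hq
  exact le_antisymm (hc q) (tsub_eq_zero_iff_le.mp this)

theorem measure_eq_sum_slices {K Q : Type*} [MeasurableSpace K] [MeasurableSpace Q]
    [MeasurableSingletonClass Q] [Fintype Q] (ν : Measure (K × Q)) {A : Set (K × Q)}
    (hA : MeasurableSet A) : ν A = ∑ q, ν (((fun k => (k, q)) ⁻¹' A) ×ˢ {q}) := by
  have hU : A = ⋃ q ∈ (Finset.univ : Finset Q), ((fun k => (k, q)) ⁻¹' A) ×ˢ {q} := by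
    ext ⟨k, q⟩
    simp
  conv_lhs => rw [hU]
  refine measure_biUnion_finset (fun q _ q' _ hqq' => ?_) fun q _ =>
    (measurable_prodMk_right hA).prod (measurableSet_singleton q)
  rw [Function.onFun, Set.disjoint_left]
  rintro ⟨k, r⟩ ⟨-, h⟩ ⟨-, h'⟩
  exact hqq' (h.symm.trans h')

section CayleyIsometries

variable {Γ : Type*} [Group Γ] {S : Set Γ}

theorem wlen_le_one_of_mem {s : Γ} (hs : s ∈ S) : wlen S s ≤ 1 :=
  sInf_le ⟨[s], by simpa using hs, by simp, by simp⟩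

theorem mem_of_wlen_le_one {g : Γ} (h : wlen S g ≤ 1) (hg : g ≠ 1) : g ∈ S := by
  have hlt : wlen S g < 2 := h.trans_lt (by norm_num)
  obtain ⟨n, ⟨l, hl, hlg, rfl⟩, hn⟩ := sInf_lt_iff.mp hlt
  match l, hl, hlg, hn with
  | [], _, hlg, _ => exact absurd hlg.symm hg
  | [a], hl, hlg, _ =>
    rw [← hlg]
    simpa using hl
  | a :: b :: l, _, _, hn =>
    have : l.length + 2 < 2 := by exact_mod_cast hn
    omega

/-- Isometries of the Cayley graph map edges to edges. -/
theorem CayleyIso.inv_mul_mem (hS : (1 : Γ) ∉ S) (f : CayleyIso S S) {a b : Γ}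
    (h : a⁻¹ * b ∈ S) : (f.toEquiv a)⁻¹ * f.toEquiv b ∈ S := by
  refine mem_of_wlen_le_one ((f.isom a b).trans_le (wlen_le_one_of_mem h)) fun h1 => hS ?_
  rw [inv_mul_eq_one, f.toEquiv.injective.eq_iff] at h1
  simpa [h1] using h

theorem IsFinGenSystem.countable (hS : IsFinGenSystem S) : Countable Γ := by
  have := hS.finite.countable.to_subtype
  have hsurj : Function.Surjective fun l : List S => (l.map Subtype.val).prod := by
    intro g
    have hg : g ∈ (Subgroup.closure S).toSubmonoid := hS.closure_eq_top ▸ Subgroup.mem_top g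
    rw [Subgroup.closure_toSubmonoid] at hg
    obtain ⟨l, hl, rfl⟩ := Submonoid.exists_list_of_mem_closure hg
    lift l to List S using fun y hy => (hl y hy).elim id fun h => by simpa using hS.inv_mem _ h
    exact ⟨l, rfl⟩
  exact hsurj.countable

theorem CayleyIso.measurableSet_apply_eq (a b : Γ) :
    MeasurableSet {f : CayleyIso S S | f.toEquiv a = b} := by
  let _ : MeasurableSpace Γ := ⊤
  have h : Measurable fun f : CayleyIso S S => fun a => f.toEquiv a := comap_measurable _
  exact (measurable_pi_apply a).comp h (MeasurableSpace.measurableSet_top (s := {b}))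

theorem CayleyIso.measurable_of_apply_eq [Countable Γ] {X : Type*} [MeasurableSpace X]
    {F : X → CayleyIso S S} (h : ∀ a b, MeasurableSet {x | (F x).toEquiv a = b}) :
    Measurable F := by
  let _ : MeasurableSpace Γ := ⊤
  refine measurable_comap_iff.mpr (measurable_pi_iff.mpr fun a => ?_)
  exact measurable_to_countable' fun b => h a b

instance [Countable Γ] : MeasurableMul₂ (CayleyIso S S) where
  measurable_mul := by
    refine CayleyIso.measurable_of_apply_eq fun a b => ?_
    have : {p : CayleyIso S S × CayleyIso S S | (p.1 * p.2).toEquiv a = b} =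
        ⋃ c, {f | f.toEquiv c = b} ×ˢ {f | f.toEquiv a = c} := by
      ext p
      simp
    rw [this]
    exact .iUnion fun c => (CayleyIso.measurableSet_apply_eq c b).prod
      (CayleyIso.measurableSet_apply_eq a c)

instance [Countable Γ] : MeasurableInv (CayleyIso S S) where
  measurable_inv := by
    refine CayleyIso.measurable_of_apply_eq fun a b => ?_
    convert CayleyIso.measurableSet_apply_eq (S := S) b a using 3 with f
    rw [CayleyIso.inv_apply, Equiv.symm_apply_eq, eq_comm]

variable (S) in
/-- The isometries of the Cayley graph fixing the identity, as a subgroup of `Iso(Γ)`. -/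
def stabOne : Subgroup (CayleyIso S S) where
  carrier := {f | f.toEquiv 1 = 1}
  mul_mem' {f g} hf hg := by
    change f.toEquiv (g.toEquiv 1) = 1
    rw [hg, hf]
  one_mem' := rfl
  inv_mem' {f} hf := (Equiv.symm_apply_eq _).mpr hf.symm

theorem mem_stabOne {f : CayleyIso S S} : f ∈ stabOne S ↔ f.toEquiv 1 = 1 := Iff.rfl

instance [Countable Γ] : MeasurableMul₂ (stabOne S) where
  measurable_mul := ((measurable_subtype_coe.comp measurable_fst).mul
    (measurable_subtype_coe.comp measurable_snd)).subtype_mk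

instance [Countable Γ] : MeasurableInv (stabOne S) where
  measurable_inv := measurable_subtype_coe.inv.subtype_mk

/-- The representative fixing the identity of the class of an isometry modulo `Γ`. -/
def rooted (f : CayleyIso S S) : stabOne S :=
  ⟨(f.toEquiv 1)⁻¹ • f, by simp [mem_stabOne]⟩

@[simp] theorem rooted_apply (f : CayleyIso S S) (a : Γ) :
    (rooted f : CayleyIso S S).toEquiv a = (f.toEquiv 1)⁻¹ * f.toEquiv a := rfl

theorem rooted_smul (g : Γ) (f : CayleyIso S S) : rooted (g • f) = rooted f :=
  Subtype.ext (CayleyIso.ext fun a => by simp [mul_assoc])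

theorem rooted_coe (k : stabOne S) : rooted (k : CayleyIso S S) = k :=
  Subtype.ext (CayleyIso.ext fun a => by simp [mem_stabOne.mp k.2])

theorem rooted_mul (f : CayleyIso S S) (k : stabOne S) :
    rooted (f * (k : CayleyIso S S)) = rooted f * k :=
  Subtype.ext (CayleyIso.ext fun a => by simp [mem_stabOne.mp k.2])

theorem measurable_const_smul_cayleyIso [Countable Γ] (g : Γ) :
    Measurable fun f : CayleyIso S S => g • f := by
  refine CayleyIso.measurable_of_apply_eq fun a b => ?_
  simp_rw [CayleyIso.smul_apply, ← eq_inv_mul_iff_mul_eq]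
  exact CayleyIso.measurableSet_apply_eq _ _

theorem measurable_rooted [Countable Γ] : Measurable (rooted (S := S)) := by
  refine (CayleyIso.measurable_of_apply_eq fun a b => ?_).subtype_mk
  have : {f : CayleyIso S S | ((f.toEquiv 1)⁻¹ • f).toEquiv a = b} =
      ⋃ c, {f | f.toEquiv 1 = c} ∩ {f | f.toEquiv a = c * b} := by
    ext f
    simp [inv_mul_eq_iff_eq_mul]
  rw [this]
  exact .iUnion fun c => (CayleyIso.measurableSet_apply_eq 1 c).inter
    (CayleyIso.measurableSet_apply_eq a _)

variable (S) in
/-- `Iso(Γ)/Γ` is isomorphic to the stabilizer of the identity. -/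
def quotientEquivStabOne [Countable Γ] :
    Quotient (MulAction.orbitRel Γ (CayleyIso S S)) ≃ᵐ stabOne S where
  toFun := Quotient.lift rooted (by
    rintro a b ⟨g, rfl⟩
    exact rooted_smul g b)
  invFun k := Quotient.mk _ k
  left_inv := by
    rintro ⟨f⟩
    exact Quotient.sound ⟨(f.toEquiv 1)⁻¹, rfl⟩
  right_inv := rooted_coe
  measurable_toFun := measurable_from_quotient.mpr measurable_rooted
  measurable_invFun := measurable_quotient_mk''.comp measurable_subtype_coe

variable (S) in
/-- `Iso(Γ)/Λ` is isomorphic to the product of the stabilizer of the identity and `Γ/Λ`. -/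
def quotientEquivStabOneProd [Countable Γ] (Λ : Subgroup Γ) [MeasurableSpace (Γ ⧸ Λ)]
    [DiscreteMeasurableSpace (Γ ⧸ Λ)] :
    Quotient (MulAction.orbitRel Λ (CayleyIso S S)) ≃ᵐ stabOne S × (Γ ⧸ Λ) where
  toFun := Quotient.lift (fun f => (rooted f, (((f.toEquiv 1)⁻¹ : Γ) : Γ ⧸ Λ))) (by
    rintro a b ⟨g, rfl⟩
    refine Prod.ext (rooted_smul (g : Γ) b) ?_
    refine QuotientGroup.eq.mpr ?_
    change (((g : Γ) * b.toEquiv 1)⁻¹)⁻¹ * (b.toEquiv 1)⁻¹ ∈ Λ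
    simp)
  invFun p := Quotient.liftOn' p.2 (fun g => Quotient.mk _ (g⁻¹ • (p.1 : CayleyIso S S))) (by
    intro a b hab
    rw [QuotientGroup.leftRel_apply] at hab
    refine Quotient.sound ⟨⟨a⁻¹ * b, hab⟩, ?_⟩
    exact CayleyIso.ext fun x => by
      change a⁻¹ * b * (b⁻¹ * _) = a⁻¹ * _
      group)
  left_inv := by
    rintro ⟨f⟩
    refine congrArg (Quotient.mk _) (CayleyIso.ext fun x => ?_)
    simp
  right_inv := by
    rintro ⟨k, ⟨g⟩⟩
    refine Prod.ext ((rooted_smul _ _).trans (rooted_coe k)) ?_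
    change ((((g⁻¹ • (k : CayleyIso S S)).toEquiv 1)⁻¹ : Γ) : Γ ⧸ Λ) = (g : Γ ⧸ Λ)
    simp [mem_stabOne.mp k.2]
  measurable_toFun := by
    refine measurable_from_quotient.mpr (measurable_rooted.prodMk ?_)
    let _ : MeasurableSpace Γ := ⊤
    refine (measurable_from_top (f := fun g : Γ => ((g⁻¹ : Γ) : Γ ⧸ Λ))).comp ?_
    exact measurable_to_countable' fun b => CayleyIso.measurableSet_apply_eq 1 b
  measurable_invFun := by
    have : Countable (Γ ⧸ Λ) := Quotient.countable
    refine measurable_from_prod_countable_left ?_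
    rintro ⟨g⟩
    exact measurable_quotient_mk''.comp
      ((measurable_const_smul_cayleyIso g⁻¹).comp measurable_subtype_coe)

theorem measurable_stabOne_apply [Countable Γ] (a : Γ) :
    @Measurable _ Γ _ ⊤ fun k : stabOne S => (k : CayleyIso S S).toEquiv a := by
  let _ : MeasurableSpace Γ := ⊤
  exact measurable_to_countable' fun b =>
    measurable_subtype_coe (CayleyIso.measurableSet_apply_eq a b)

theorem stabOne_measure_fixing_ne_zero [Countable Γ] (κ : Measure (stabOne S))
    [IsProbabilityMeasure κ] [κ.IsMulLeftInvariant] (a : Γ) :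
    κ {k | (k : CayleyIso S S).toEquiv a = a} ≠ 0 := by
  intro h0
  have hnull (b : Γ) : κ {k | (k : CayleyIso S S).toEquiv a = b} = 0 := by
    by_cases hb : ∃ k : stabOne S, (k : CayleyIso S S).toEquiv a = b
    · obtain ⟨k, hk⟩ := hb
      rw [← h0, ← measure_preimage_mul κ k]
      congr 1
      ext k'
      simp [← hk]
    · simp only [not_exists] at hb
      simp [hb]
  have hU : (Set.univ : Set (stabOne S)) =
      ⋃ b, {k : stabOne S | (k : CayleyIso S S).toEquiv a = b} := by
    ext k
    simp
  have := measure_iUnion_null hnull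
  rw [← hU, measure_univ] at this
  exact one_ne_zero this

/-- A measure on `stabOne S × Γ/Λ` which is invariant under right translations by `stabOne S` and
under the skew product action of `Γ` is a product measure with uniform second marginal. -/
theorem eq_prod_of_invariant [Countable Γ] (Λ : Subgroup Γ) [Finite (Γ ⧸ Λ)]
    [MeasurableSpace (Γ ⧸ Λ)] [DiscreteMeasurableSpace (Γ ⧸ Λ)]
    (κ : Measure (stabOne S)) [IsProbabilityMeasure κ] [κ.IsMulRightInvariant]
    (ν : Measure (stabOne S × (Γ ⧸ Λ))) [IsProbabilityMeasure ν]
    (hν : ∀ k : stabOne S,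
      MeasurePreserving (fun p : stabOne S × (Γ ⧸ Λ) => (p.1 * k, p.2)) ν ν)
    (hν' : ∀ (a : Γ) (q : Γ ⧸ Λ),
      ν {p | ((p.1 : CayleyIso S S).toEquiv a)⁻¹ • p.2 = q} = ν (Set.univ ×ˢ {q}))
    (u : Measure (Γ ⧸ Λ)) [IsProbabilityMeasure u]
    (hu : ∀ q : Γ ⧸ Λ, u {q} = (Nat.card (Γ ⧸ Λ) : ENNReal)⁻¹) :
    ν = κ.prod u := by
  let _ : Fintype (Γ ⧸ Λ) := Fintype.ofFinite _
  have hκ : κ.IsMulLeftInvariant := inv_eq_self_of_rightInvariant κ ▸ inferInstance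
  have hslice (q : Γ ⧸ Λ) {A : Set (stabOne S)} (hA : MeasurableSet A) :
      ν (A ×ˢ {q}) = ν (Set.univ ×ˢ {q}) * κ A := by
    have hmap {B : Set (stabOne S)} (hB : MeasurableSet B) :
        (ν.restrict (Set.univ ×ˢ {q})).map Prod.fst B = ν (B ×ˢ {q}) := by
      rw [Measure.map_apply measurable_fst hB, Measure.restrict_apply (measurable_fst hB)]
      congr 1
      ext p
      simp
    have : ((ν.restrict (Set.univ ×ˢ {q})).map Prod.fst).IsMulRightInvariant := by
      refine ⟨fun k => Measure.ext fun B hB => ?_⟩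
      have hk : Measurable (· * k) := measurable_mul_const k
      rw [Measure.map_apply hk hB, hmap (hk hB), hmap hB,
        ← (hν k).measure_preimage (hB.prod (measurableSet_singleton q)).nullMeasurableSet]
      rfl
    rw [← hmap hA, eq_smul_of_rightInvariant_of_leftInvariant
      ((ν.restrict (Set.univ ×ˢ {q})).map Prod.fst) κ, hmap .univ]
    rfl
  have hconst : ∃ C, ∀ q, ν (Set.univ ×ˢ {q}) = C := by
    obtain ⟨q₀, hq₀⟩ := Finite.exists_max fun q : Γ ⧸ Λ => ν (Set.univ ×ˢ {q})
    refine ⟨ν (Set.univ ×ˢ {q₀}), fun q => ?_⟩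
    obtain ⟨a, rfl⟩ := MulAction.exists_smul_eq Γ q₀ q
    have hmeas := (measurable_from_top (f := fun g : Γ => g • q₀)).comp
      (measurable_stabOne_apply (S := S) a)
    have hset : MeasurableSet {p : stabOne S × (Γ ⧸ Λ) |
        ((p.1 : CayleyIso S S).toEquiv a)⁻¹ • p.2 = q₀} := by
      have : {p : stabOne S × (Γ ⧸ Λ) | ((p.1 : CayleyIso S S).toEquiv a)⁻¹ • p.2 = q₀} =
          ⋃ q, ((fun k : stabOne S => (k : CayleyIso S S).toEquiv a • q₀) ⁻¹' {q}) ×ˢ {q} := by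
        ext p
        simp [inv_smul_eq_iff, eq_comm (a := p.2)]
      rw [this]
      exact .iUnion fun q => (hmeas (measurableSet_singleton q)).prod (measurableSet_singleton q)
    refine eq_of_weighted_average (p := fun q => κ {k | (k : CayleyIso S S).toEquiv a • q₀ = q})
      ?_ (measure_ne_top _ _) hq₀ ?_ ?_
    · have := sum_measure_preimage_singleton (μ := κ) Finset.univ
        fun q _ => hmeas (measurableSet_singleton q)
      rw [Finset.coe_univ, Set.preimage_univ, measure_univ] at this
      exact this
    · rw [← hν' a q₀, measure_eq_sum_slices ν hset]
      refine Finset.sum_congr rfl fun q _ => ?_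
      refine (hslice q (hmeas (measurableSet_singleton q))).symm.trans ?_
      congr 2
      ext k
      simp [inv_smul_eq_iff, eq_comm (a := q)]
    · intro h0
      refine stabOne_measure_fixing_ne_zero κ a (measure_mono_null (fun k hk => ?_) h0)
      simpa using congrArg (· • q₀) hk
  obtain ⟨C, hC⟩ := hconst
  have hC' : C = (Nat.card (Γ ⧸ Λ) : ENNReal)⁻¹ := by
    have := measure_eq_sum_slices ν MeasurableSet.univ
    simp only [Set.preimage_univ, hC, measure_univ, Finset.sum_const, nsmul_eq_mul] at this
    rw [Nat.card_eq_fintype_card]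
    exact ENNReal.eq_inv_of_mul_eq_one_left ((mul_comm _ _).trans this.symm)
  ext A hA
  rw [measure_eq_sum_slices ν hA, measure_eq_sum_slices (κ.prod u) hA]
  refine Finset.sum_congr rfl fun q _ => ?_
  rw [hslice q (measurable_prodMk_right hA), hC, Measure.prod_prod, hu, hC', mul_comm]

variable (S) in
/-- The isomorphism `Iso(Γ)/Λ ≃ Iso(Γ)/Γ × Γ/Λ` obtained by inverting the normalized
representative of an isometry. -/
def quotientEquivProd [Countable Γ] (Λ : Subgroup Γ) [MeasurableSpace (Γ ⧸ Λ)]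
    [DiscreteMeasurableSpace (Γ ⧸ Λ)] :
    Quotient (MulAction.orbitRel Λ (CayleyIso S S)) ≃ᵐ
      Quotient (MulAction.orbitRel Γ (CayleyIso S S)) × (Γ ⧸ Λ) :=
  (quotientEquivStabOneProd S Λ).trans
    (((MeasurableEquiv.inv (stabOne S)).trans (quotientEquivStabOne S).symm).prodCongr
      (MeasurableEquiv.refl _))

theorem quotientEquivProd_subQ [Countable Γ] (Λ : Subgroup Γ) [MeasurableSpace (Γ ⧸ Λ)]
    [DiscreteMeasurableSpace (Γ ⧸ Λ)] (f : CayleyIso S S) (s : Γ) :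
    quotientEquivProd S Λ (subQ Λ (CayleyIso.leftMult S s) (Quotient.mk _ f)) =
      (preQ (CayleyIso.leftMult S ((f.toEquiv s⁻¹)⁻¹ * f.toEquiv 1))
        (quotientEquivProd S Λ (Quotient.mk _ f)).1,
      ((f.toEquiv s⁻¹)⁻¹ * f.toEquiv 1) • (quotientEquivProd S Λ (Quotient.mk _ f)).2) := by
  set t := (f.toEquiv s⁻¹)⁻¹ * f.toEquiv 1 with ht
  refine Prod.ext (Quotient.sound ⟨s, CayleyIso.ext fun x => ?_⟩) ?_
  · change s * (rooted f : CayleyIso S S).toEquiv.symm (t⁻¹ * x) =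
      (rooted (f * (CayleyIso.leftMult S s)⁻¹) : CayleyIso S S).toEquiv.symm x
    obtain ⟨z, hz⟩ := (rooted f : CayleyIso S S).toEquiv.surjective (t⁻¹ * x)
    rw [← hz, Equiv.symm_apply_apply, eq_comm, Equiv.symm_apply_eq]
    rw [rooted_apply, inv_mul_eq_iff_eq_mul, ht] at hz
    change x = (f.toEquiv (s⁻¹ * 1))⁻¹ * f.toEquiv (s⁻¹ * (s * z))
    rw [inv_mul_cancel_left, hz, mul_one]
    group
  · change (((f.toEquiv (s⁻¹ * 1))⁻¹ : Γ) : Γ ⧸ Λ) = ((t * (f.toEquiv 1)⁻¹ : Γ) : Γ ⧸ Λ)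
    simp [ht]

end CayleyIsometries

end IOE

/-- For a finite index subgroup `Λ ≤ Γ`, the p.m.p. action
`Γ ↷ (Iso(Γ)/Λ, m_Λ)` is isometric orbit equivalent to the diagonal action
`Γ ↷ (Iso(Γ)/Γ × Γ/Λ, m_Γ ⊗ u)`. -/
theorem stmt9
    {Γ : Type*} [Group Γ]
    (SΓ : Set Γ) (hSΓ : IsFinGenSystem SΓ)
    (Λ : Subgroup Γ) [Λ.FiniteIndex]
    [MeasurableSpace (Γ ⧸ Λ)] [DiscreteMeasurableSpace (Γ ⧸ Λ)]
    -- the Haar probability measure `m_Λ` on `Iso(Γ)/Λ`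
    (mΛ : Measure (Quotient (MulAction.orbitRel ↥Λ (CayleyIso SΓ SΓ))))
    [IsProbabilityMeasure mΛ]
    (hmΛ : ∀ g : CayleyIso SΓ SΓ, MeasurePreserving (subQ Λ g) mΛ mΛ)
    -- the Haar probability measure `m_Γ` on `Iso(Γ)/Γ`
    (mΓ : Measure (Quotient (MulAction.orbitRel Γ (CayleyIso SΓ SΓ))))
    [IsProbabilityMeasure mΓ]
    (hmΓ : ∀ g : CayleyIso SΓ SΓ, MeasurePreserving (preQ g) mΓ mΓ)
    -- the uniform probability measure `u` on `Γ/Λ`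
    (u : Measure (Γ ⧸ Λ)) [IsProbabilityMeasure u]
    (hu : ∀ q : Γ ⧸ Λ, u {q} = (Nat.card (Γ ⧸ Λ) : ENNReal)⁻¹) :
    IsomOrbitEquiv
      (fun γ : Γ => subQ Λ (CayleyIso.leftMult SΓ γ)) SΓ mΛ
      (fun (γ : Γ) (p : Quotient (MulAction.orbitRel Γ (CayleyIso SΓ SΓ)) × (Γ ⧸ Λ)) =>
        (preQ (CayleyIso.leftMult SΓ γ) p.1, γ • p.2)) SΓ (mΓ.prod u) := by
  have := hSΓ.countable
  set EΓ := quotientEquivStabOne SΓ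
  set EΛ := quotientEquivStabOneProd SΓ Λ
  have hκ : IsProbabilityMeasure (mΓ.map EΓ) :=
    Measure.isProbabilityMeasure_map EΓ.measurable.aemeasurable
  have hν : IsProbabilityMeasure (mΛ.map EΛ) :=
    Measure.isProbabilityMeasure_map EΛ.measurable.aemeasurable
  have hκr : (mΓ.map EΓ).IsMulRightInvariant := by
    refine ⟨fun k => ?_⟩
    refine (MeasurePreserving.of_semiconj (EΓ.measurable.measurePreserving mΓ)
      (hmΓ (k⁻¹ : stabOne SΓ)) ?_ (measurable_mul_const k)).map_eq
    rintro ⟨f⟩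
    exact (congrArg (fun g => rooted (f * g)) (inv_inv (k : CayleyIso SΓ SΓ))).trans
      (rooted_mul f k)
  have hprod : mΛ.map EΛ = (mΓ.map EΓ).prod u := by
    refine eq_prod_of_invariant Λ _ _ (fun k => ?_) (fun a q => ?_) u hu
    · refine MeasurePreserving.of_semiconj (EΛ.measurable.measurePreserving mΛ)
        (hmΛ (k⁻¹ : stabOne SΓ)) ?_ ((measurable_fst.mul_const k).prodMk measurable_snd)
      rintro ⟨f⟩
      refine Prod.ext ((congrArg (fun g => rooted (f * g)) (inv_inv (k : CayleyIso SΓ SΓ))).trans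
        (rooted_mul f k)) ?_
      exact congrArg (fun a : Γ => (((f.toEquiv a)⁻¹ : Γ) : Γ ⧸ Λ)) (mem_stabOne.mp k.2)
    · rw [EΛ.map_apply, EΛ.map_apply, ← (hmΛ (CayleyIso.leftMult SΓ a⁻¹)).measure_preimage
        (EΛ.measurable (MeasurableSet.univ.prod (measurableSet_singleton q))).nullMeasurableSet]
      congr 1
      ext ⟨f⟩
      have h₁ : EΛ (Quotient.mk _ f) = (rooted f, (((f.toEquiv 1)⁻¹ : Γ) : Γ ⧸ Λ)) := rfl
      have h₂ : (EΛ (subQ Λ (CayleyIso.leftMult SΓ a⁻¹) (Quotient.mk _ f))).2 =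
        (((f.toEquiv ((a⁻¹)⁻¹ * 1))⁻¹ : Γ) : Γ ⧸ Λ) := rfl
      change ((EΛ (Quotient.mk _ f)).1.1.toEquiv a)⁻¹ • (EΛ (Quotient.mk _ f)).2 = q ↔
        EΛ (subQ Λ (CayleyIso.leftMult SΓ a⁻¹) (Quotient.mk _ f)) ∈ Set.univ ×ˢ {q}
      rw [Set.mem_prod, h₁, h₂]
      change (((((f.toEquiv 1)⁻¹ * f.toEquiv a)⁻¹ * (f.toEquiv 1)⁻¹ : Γ) : Γ ⧸ Λ)) = q ↔ _
      simp
  refine isomOrbitEquiv_of_edge_equiv (quotientEquivProd SΓ Λ) ?_ ?_ ?_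
  · have hEΛm : MeasurePreserving EΛ mΛ ((mΓ.map EΓ).prod u) := ⟨EΛ.measurable, hprod⟩
    have hinv : MeasurePreserving (MeasurableEquiv.inv (stabOne SΓ)) (mΓ.map EΓ) (mΓ.map EΓ) :=
      ⟨measurable_inv, inv_eq_self_of_rightInvariant _⟩
    have hEΓm : MeasurePreserving EΓ mΓ (mΓ.map EΓ) := EΓ.measurable.measurePreserving mΓ
    exact (((hEΓm.symm EΓ).comp hinv).prod (MeasurePreserving.id u)).comp hEΛm
  · rintro ⟨f⟩ s hs
    exact ⟨_, f.inv_mul_mem hSΓ.one_not_mem (by simpa using hs), quotientEquivProd_subQ Λ f s⟩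
  · rintro ⟨f⟩ t ht
    refine ⟨(f.toEquiv.symm (f.toEquiv 1 * t⁻¹))⁻¹, ?_, ?_⟩
    · simpa using f⁻¹.inv_mul_mem (a := f.toEquiv 1 * t⁻¹) (b := f.toEquiv 1) hSΓ.one_not_mem
        (by simpa using ht)
    · have h := quotientEquivProd_subQ Λ f (f.toEquiv.symm (f.toEquiv 1 * t⁻¹))⁻¹
      simp only [inv_inv, Equiv.apply_symm_apply, mul_inv_rev, inv_mul_cancel_right] at h
      exact h
end

section
/- Let Γ and Λ be countable groups, let Φ be an orbit equivalence between p.m.p. essentially free actions Γ ↷ (X,μ) and Λ ↷ (Y,ν), and let σ : Γ × X → Λ and τ : Λ × Y → Γ be the orbit equivalence cocycles associated with Φ. For x ∈ X define σ_x : Γ → Λ by σ_x(γ) := σ(γ⁻¹,x)⁻¹, and for y ∈ Y define τ_y : Λ → Γ by τ_y(λ) := τ(λ⁻¹,y)⁻¹. Then for μ-a.e. x and ν-a.e. y, σ_x and τ_y are bijections with σ_x(1_Γ) = 1_Λ and τ_y(1_Λ) = 1_Γ; the map x ↦ σ_x is Γ-equivariant for the action (γ·f)(δ) := f(γ⁻¹)⁻¹f(γ⁻¹δ)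 on maps f : Γ → Λ with f(1_Γ) = 1_Λ, and y ↦ τ_y is Λ-equivariant for the analogous action. Consequently, the pushforward of μ by x ↦ σ_x is a Γ-invariant probability measure on the space [Γ,Λ] of maps f : Γ → Λ with f(1_Γ) = 1_Λ, supported on bijections. -/
open MeasureTheory

open MeasureTheory IOE

namespace IOE

/-- `Φ` is an orbit equivalence between the actions `actA` on `(X,μ)` and `actB` on `(Y,ν)`. -/
def IsOrbitEquiv {G H X Y : Type*} [MeasurableSpace X] [MeasurableSpace Y]
    (actA : G → X → X) (μ : Measure X) (actB : H → Y → Y) (ν : Measure Y)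
    (Φ : X ≃ Y) : Prop :=
  Measurable Φ ∧ Measurable Φ.symm ∧ MeasurePreserving Φ μ ν ∧
    ∀ᵐ x ∂μ, Φ '' (Set.range fun g => actA g x) = Set.range fun h => actB h (Φ x)

/-- The natural action of `Γ` on the space `[Γ,Λ]` of maps `f : Γ → Λ` with
`f(1) = 1` : `(γ·f)(δ) = f(γ⁻¹)⁻¹ f(γ⁻¹δ)`. -/
def mapsAct {Γ Λ : Type*} [Group Γ] [Group Λ] (γ : Γ) (f : Γ → Λ) : Γ → Λ :=
  fun δ => (f γ⁻¹)⁻¹ * f (γ⁻¹ * δ)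

end IOE

namespace IOE

/-- The inverse of an orbit equivalence is an orbit equivalence. -/
theorem IsOrbitEquiv.symm {Γ Λ X Y : Type*} [MeasurableSpace X] [MeasurableSpace Y]
    {μ : Measure X} {ν : Measure Y} {α : Γ → X → X} {β : Λ → Y → Y} {Φ : X ≃ Y}
    (h : IsOrbitEquiv α μ β ν Φ) : IsOrbitEquiv β ν α μ Φ.symm := by
  obtain ⟨hm, hm', hmp, horb⟩ := h
  have hmp' : MeasurePreserving Φ.symm ν μ :=
    MeasurePreserving.symm (⟨Φ, hm, hm'⟩ : X ≃ᵐ Y) hmp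
  refine ⟨hm', hm, hmp', ?_⟩
  filter_upwards [hmp'.quasiMeasurePreserving.ae horb] with y hy
  rw [Φ.apply_symm_apply] at hy
  rw [← hy, Equiv.symm_image_image]

section CocycleMaps

variable {Γ Λ X Y : Type*} [Group Γ] [Group Λ] [MeasurableSpace X] [MeasurableSpace Y]
  {μ : Measure X} {ν : Measure Y} {α : Γ → X → X} {β : Λ → Y → Y} {Φ : X ≃ Y}
  {σ : Γ → X → Λ}

/-- An element of an action is determined by its value at a point with trivial stabilizer. -/
theorem IsPmpAction.eq_of_act_eq (hβ : IsPmpAction β ν) {y : Y}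
    (hy : ∀ h : Λ, β h y = y → h = 1) {a b : Λ} (hab : β a y = β b y) : a = b := by
  have h : β (b⁻¹ * a) y = y := by
    rw [hβ.mul_act, hab, ← hβ.mul_act, inv_mul_cancel, hβ.one_act]
  exact (inv_mul_eq_one.mp (hy _ h)).symm

/-- Almost every `γ ↦ σ(γ⁻¹, x)⁻¹` is a bijection fixing the identity. -/
theorem IsOrbitEquiv.ae_bijective [Countable Γ]
    (hα : IsPmpAction α μ) (hβ : IsPmpAction β ν)
    (hαfree : EssentiallyFree α μ) (hβfree : EssentiallyFree β ν)
    (hΦ : IsOrbitEquiv α μ β ν Φ)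
    (hσ : ∀ γ : Γ, ∀ᵐ x ∂μ, Φ (α γ x) = β (σ γ x) (Φ x)) :
    ∀ᵐ x ∂μ, Function.Bijective (fun γ : Γ => (σ γ⁻¹ x)⁻¹) ∧
      (σ (1 : Γ)⁻¹ x)⁻¹ = (1 : Λ) := by
  obtain ⟨-, -, hmp, horb⟩ := hΦ
  filter_upwards [hαfree, hmp.quasiMeasurePreserving.ae hβfree, horb, ae_all_iff.mpr hσ]
    with x hx hy ho hs
  refine ⟨⟨fun γ δ h => ?_, fun l => ?_⟩, ?_⟩
  · have h' : σ γ⁻¹ x = σ δ⁻¹ x := inv_injective h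
    have h2 : α γ⁻¹ x = α δ⁻¹ x := Φ.injective (by rw [hs, hs, h'])
    exact inv_injective (hα.eq_of_act_eq hx h2)
  · have hl : β l⁻¹ (Φ x) ∈ Φ '' (Set.range fun g => α g x) := by
      rw [ho]
      exact ⟨l⁻¹, rfl⟩
    obtain ⟨_, ⟨g, rfl⟩, hg⟩ := hl
    have h2 : σ g x = l⁻¹ := hβ.eq_of_act_eq hy (by rw [← hs]; exact hg)
    exact ⟨g⁻¹, by simp [h2]⟩
  · have h := hs 1
    rw [hα.one_act] at h
    rw [inv_one, hy _ h.symm, inv_one]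

/-- The map `x ↦ (γ ↦ σ(γ⁻¹, x)⁻¹)` is almost everywhere equivariant. -/
theorem IsOrbitEquiv.ae_equivariant [Countable Γ]
    (hα : IsPmpAction α μ) (hβ : IsPmpAction β ν) (hβfree : EssentiallyFree β ν)
    (hΦ : IsOrbitEquiv α μ β ν Φ)
    (hσ : ∀ γ : Γ, ∀ᵐ x ∂μ, Φ (α γ x) = β (σ γ x) (Φ x)) (γ : Γ) :
    ∀ᵐ x ∂μ,
      (fun δ : Γ => (σ δ⁻¹ (α γ x))⁻¹) = mapsAct γ (fun δ : Γ => (σ δ⁻¹ x)⁻¹) := by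
  obtain ⟨-, -, hmp, -⟩ := hΦ
  have hσ' := ae_all_iff.mpr hσ
  filter_upwards [hmp.quasiMeasurePreserving.ae hβfree, hσ',
    (hα.measurePreserving γ).quasiMeasurePreserving.ae hσ'] with x hy hs hs'
  funext δ
  have h : σ (δ⁻¹ * γ) x = σ δ⁻¹ (α γ x) * σ γ x := by
    apply hβ.eq_of_act_eq hy
    rw [← hs, hα.mul_act, hs', hs, hβ.mul_act]
  simp [mapsAct, h]

end CocycleMaps

section Measurability

variable {Γ Λ : Type*} [Group Γ] [Group Λ] [Countable Λ] [MeasurableSpace Λ]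
  [DiscreteMeasurableSpace Λ]

theorem measurable_mapsAct (γ : Γ) : Measurable (mapsAct γ : (Γ → Λ) → Γ → Λ) := by
  refine measurable_pi_lambda _ fun δ => ?_
  have h : Measurable fun f : Γ → Λ => (f γ⁻¹, f (γ⁻¹ * δ)) :=
    (measurable_pi_apply γ⁻¹).prodMk (measurable_pi_apply (γ⁻¹ * δ))
  exact (Measurable.of_discrete (f := fun p : Λ × Λ => p.1⁻¹ * p.2)).comp h

theorem measurableSet_bijective_map_one [Countable Γ] :
    MeasurableSet {f : Γ → Λ | Function.Bijective f ∧ f 1 = 1} := by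
  have hev (a : Γ) (l : Λ) : MeasurableSet {f : Γ → Λ | f a = l} :=
    measurableSet_eq_fun (measurable_pi_apply a) measurable_const
  have heq (a b : Γ) : MeasurableSet {f : Γ → Λ | f a = f b} :=
    measurableSet_eq_fun (measurable_pi_apply a) (measurable_pi_apply b)
  have hinj : MeasurableSet {f : Γ → Λ | Function.Injective f} := by
    simp only [Function.Injective, Set.ofPred_forall]
    exact MeasurableSet.iInter fun a => MeasurableSet.iInter fun b =>
      (heq a b).imp (MeasurableSet.const _)
  have hsurj : MeasurableSet {f : Γ → Λ | Function.Surjective f} := by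
    simp only [Function.Surjective, Set.ofPred_forall, Set.ofPred_exists]
    exact MeasurableSet.iInter fun l => MeasurableSet.iUnion fun a => hev a l
  exact (hinj.inter hsurj).inter (hev 1 1)

end Measurability

end IOE

/-- The orbit equivalence cocycles of an orbit equivalence between
p.m.p. essentially free actions give rise to equivariant maps `x ↦ σ_x`, `y ↦ τ_y`
into the spaces of bijections fixing the identity; the pushforward of `μ` by `x ↦ σ_x`
is a `Γ`-invariant probability measure on `[Γ,Λ]` supported on bijections. -/
theorem stmt17
    {Γ Λ X Y : Type*} [Group Γ] [Countable Γ] [Group Λ] [Countable Λ]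
    [MeasurableSpace Λ] [DiscreteMeasurableSpace Λ]
    [MeasurableSpace Γ] [DiscreteMeasurableSpace Γ]
    [MeasurableSpace X] [StandardBorelSpace X] [MeasurableSpace Y] [StandardBorelSpace Y]
    (μ : Measure X) (ν : Measure Y) [IsProbabilityMeasure μ] [IsProbabilityMeasure ν]
    (α : Γ → X → X) (β : Λ → Y → Y)
    (hα : IsPmpAction α μ) (hβ : IsPmpAction β ν)
    (hαfree : EssentiallyFree α μ) (hβfree : EssentiallyFree β ν)
    (Φ : X ≃ Y) (hΦ : IsOrbitEquiv α μ β ν Φ)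
    (σ : Γ → X → Λ) (τ : Λ → Y → Γ)
    (hσmeas : ∀ (γ : Γ) (lam : Λ), MeasurableSet {x | σ γ x = lam})
    (hτmeas : ∀ (lam : Λ) (γ : Γ), MeasurableSet {y | τ lam y = γ})
    (hσ : ∀ γ : Γ, ∀ᵐ x ∂μ, Φ (α γ x) = β (σ γ x) (Φ x))
    (hτ : ∀ lam : Λ, ∀ᵐ y ∂ν, Φ (α (τ lam y) (Φ.symm y)) = β lam y) :
    -- `σ_x` and `τ_y` are a.e. bijections fixing the identity
    (∀ᵐ x ∂μ, Function.Bijective (fun γ : Γ => (σ γ⁻¹ x)⁻¹) ∧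
      (σ (1 : Γ)⁻¹ x)⁻¹ = (1 : Λ)) ∧
    (∀ᵐ y ∂ν, Function.Bijective (fun lam : Λ => (τ lam⁻¹ y)⁻¹) ∧
      (τ (1 : Λ)⁻¹ y)⁻¹ = (1 : Γ)) ∧
    -- equivariance of `x ↦ σ_x` and `y ↦ τ_y`
    (∀ γ : Γ, ∀ᵐ x ∂μ,
      (fun δ : Γ => (σ δ⁻¹ (α γ x))⁻¹) = mapsAct γ (fun δ : Γ => (σ δ⁻¹ x)⁻¹)) ∧
    (∀ lam : Λ, ∀ᵐ y ∂ν,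
      (fun e : Λ => (τ e⁻¹ (β lam y))⁻¹) = mapsAct lam (fun e : Λ => (τ e⁻¹ y)⁻¹)) ∧
    -- the pushforward of `μ` is a `Γ`-invariant probability measure on `[Γ,Λ]`
    -- supported on bijections
    (IsProbabilityMeasure (μ.map (fun x (γ : Γ) => (σ γ⁻¹ x)⁻¹)) ∧
      (∀ γ : Γ, (μ.map (fun x (δ : Γ) => (σ δ⁻¹ x)⁻¹)).map (mapsAct γ)
        = μ.map (fun x (δ : Γ) => (σ δ⁻¹ x)⁻¹)) ∧
      (μ.map (fun x (δ : Γ) => (σ δ⁻¹ x)⁻¹))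
        {f : Γ → Λ | ¬ (Function.Bijective f ∧ f 1 = 1)} = 0) := by
  have hτ' : ∀ lam : Λ, ∀ᵐ y ∂ν, Φ.symm (β lam y) = α (τ lam y) (Φ.symm y) := by
    intro lam
    filter_upwards [hτ lam] with y hy
    rw [← hy, Φ.symm_apply_apply]
  have hbij := hΦ.ae_bijective hα hβ hαfree hβfree hσ
  have hequiv := hΦ.ae_equivariant hα hβ hβfree hσ
  have hmeas : Measurable (fun x (γ : Γ) => (σ γ⁻¹ x)⁻¹) :=
    measurable_pi_lambda _ fun γ =>
      (Measurable.of_discrete (f := fun l : Λ => l⁻¹)).comp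
        (measurable_to_countable' fun l => hσmeas γ⁻¹ l)
  refine ⟨hbij, hΦ.symm.ae_bijective hβ hα hβfree hαfree hτ', hequiv,
    hΦ.symm.ae_equivariant hβ hα hαfree hτ', Measure.isProbabilityMeasure_map hmeas.aemeasurable,
    fun γ => ?_, ?_⟩
  · rw [Measure.map_map (measurable_mapsAct γ) hmeas]
    have hγ := hα.measurePreserving γ
    calc
      _ = μ.map ((fun x (δ : Γ) => (σ δ⁻¹ x)⁻¹) ∘ α γ) :=
        Measure.map_congr ((hequiv γ).mono fun x hx => hx.symm)
      _ = _ := by rw [← Measure.map_map hmeas hγ.measurable, hγ.map_eq]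
  · exact (ae_map_iff hmeas.aemeasurable measurableSet_bijective_map_one).mpr hbij
end

section
/- Let Γ = ⟨S_Γ⟩ and Λ = ⟨S_Λ⟩ be countable groups with fixed generating systems, let Φ be a length-preserving orbit equivalence between p.m.p. essentially free actions Γ ↷ (X,μ) and Λ ↷ (Y,ν), and let σ, τ be the orbit equivalence cocycles associated with Φ. Define σ_x(γ) := σ(γ⁻¹,x)⁻¹ and τ_y(λ) := τ(λ⁻¹,y)⁻¹. Then for μ-a.e. x and ν-a.e. y, σ_x is a bijective isometry from the Cayley graph (Γ,S_Γ) to (Λ,S_Λ) with σ_x(1_Γ) = 1_Λ, and τ_y is a bijective isometry from (Λ,S_Λ) to (Γ,S_Γ) with τ_y(1_Λ) = 1_Γ; moreover x ↦ σ_x is Γ-equivariant and y ↦ τ_y is Λ-equivariant for the actions (γ·f)(δ) := f(γ⁻¹)⁻¹f(γ⁻¹δ). Consequently the pushforward of μ by x ↦ σ_x is a Γ-invariant probability measure on Iso₁(Γ,Λ). -/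
open MeasureTheory

open MeasureTheory IOE

namespace IOE

section OrbitCocycles

variable {G H X Y : Type*} [Group G] [Group H] [MeasurableSpace X] [MeasurableSpace Y]
  {μ : Measure X} {ν : Measure Y} {act : G → X → X} {act' : H → Y → Y}

theorem IsPmpAction.eq_of_act_eq_s18 (hact : IsPmpAction act μ) {x : X}
    (hx : ∀ g, act g x = x → g = 1) {a b : G} (h : act a x = act b x) : a = b := by
  have hab : act (b⁻¹ * a) x = x := by
    rw [hact.mul_act, h, ← hact.mul_act, inv_mul_cancel, hact.one_act]
  exact (inv_mul_eq_one.mp (hx _ hab)).symm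

/-- The cocycle of an orbit map into an essentially free action satisfies the cocycle
identity. -/
theorem orbitCocycle_mul (hact : IsPmpAction act μ) (hact' : IsPmpAction act' ν)
    (hfree' : EssentiallyFree act' ν) {Φ : X → Y} (hΦ : Measure.QuasiMeasurePreserving Φ μ ν)
    {σ : G → X → H} (hσ : ∀ g, ∀ᵐ x ∂μ, Φ (act g x) = act' (σ g x) (Φ x)) (g h : G) :
    ∀ᵐ x ∂μ, σ (g * h) x = σ g (act h x) * σ h x := by
  filter_upwards [hσ (g * h), hσ h,
    (hact.measurePreserving h).quasiMeasurePreserving.ae (hσ g), hΦ.ae hfree']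
    with x h₁ h₂ h₃ hx
  apply hact'.eq_of_act_eq_s18 hx
  rw [← h₁, hact.mul_act, h₃, h₂, hact'.mul_act]

theorem orbitCocycle_one (hact : IsPmpAction act μ)
    (hfree' : EssentiallyFree act' ν) {Φ : X → Y} (hΦ : Measure.QuasiMeasurePreserving Φ μ ν)
    {σ : G → X → H} (hσ : ∀ g, ∀ᵐ x ∂μ, Φ (act g x) = act' (σ g x) (Φ x)) :
    ∀ᵐ x ∂μ, σ 1 x = 1 := by
  filter_upwards [hσ 1, hΦ.ae hfree'] with x h₁ hx
  exact hx _ (by rw [← h₁, hact.one_act])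

theorem orbitCocycle_bijective [Countable G] [Countable H]
    (hact : IsPmpAction act μ) (hact' : IsPmpAction act' ν)
    (hfree : EssentiallyFree act μ) (hfree' : EssentiallyFree act' ν)
    {Φ : X ≃ Y} (hΦ : Measure.QuasiMeasurePreserving Φ μ ν)
    {σ : G → X → H} {τ : H → Y → G}
    (hσ : ∀ g, ∀ᵐ x ∂μ, Φ (act g x) = act' (σ g x) (Φ x))
    (hτ : ∀ h, ∀ᵐ y ∂ν, Φ (act (τ h y) (Φ.symm y)) = act' h y) :
    ∀ᵐ x ∂μ, Function.Bijective (fun g => σ g x) := by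
  filter_upwards [ae_all_iff.mpr hσ, hΦ.ae (ae_all_iff.mpr hτ), hfree, hΦ.ae hfree']
    with x h₁ h₂ hx hx'
  refine ⟨fun a b hab => ?_, fun h => ⟨τ h (Φ x), ?_⟩⟩
  · apply hact.eq_of_act_eq_s18 hx
    apply Φ.injective
    rw [h₁, h₁]
    exact congrArg (fun c => act' c (Φ x)) hab
  · apply hact'.eq_of_act_eq_s18 hx'
    have := h₂ h
    rw [Φ.symm_apply_apply] at this
    rw [← h₁, this]

theorem orbitCocycle_isometry [Countable G] [Countable H]
    (hact : IsPmpAction act μ) (hact' : IsPmpAction act' ν)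
    (hfree : EssentiallyFree act μ) (hfree' : EssentiallyFree act' ν)
    {Φ : X ≃ Y} (hΦ : Measure.QuasiMeasurePreserving Φ μ ν)
    {σ : G → X → H} {τ : H → Y → G} {SG : Set G} {SH : Set H}
    (hσ : ∀ g, ∀ᵐ x ∂μ, Φ (act g x) = act' (σ g x) (Φ x))
    (hτ : ∀ h, ∀ᵐ y ∂ν, Φ (act (τ h y) (Φ.symm y)) = act' h y)
    (hlen : LengthPreservingCocycle SG SH μ σ) :
    ∀ᵐ x ∂μ, Function.Bijective (fun g => (σ g⁻¹ x)⁻¹) ∧ (σ (1 : G)⁻¹ x)⁻¹ = 1 ∧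
      ∀ g h : G, wlen SH (σ g⁻¹ x * (σ h⁻¹ x)⁻¹) = wlen SG (g⁻¹ * h) := by
  have hmul : ∀ᵐ x ∂μ, ∀ g h : G, σ (g * h) x = σ g (act h x) * σ h x :=
    ae_all_iff.mpr fun g => ae_all_iff.mpr fun h =>
      orbitCocycle_mul hact hact' hfree' hΦ hσ g h
  have hlen' : ∀ᵐ x ∂μ, ∀ g h : G, wlen SH (σ g (act h x)) = wlen SG g :=
    ae_all_iff.mpr fun g => ae_all_iff.mpr fun h =>
      (hact.measurePreserving h).quasiMeasurePreserving.ae (hlen g)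
  filter_upwards [orbitCocycle_bijective hact hact' hfree hfree' hΦ hσ hτ,
    orbitCocycle_one hact hfree' hΦ hσ, hmul, hlen'] with x hbij hone hmul hlen'
  refine ⟨(Equiv.inv H).bijective.comp (hbij.comp (Equiv.inv G).bijective),
    by rw [inv_one, hone, inv_one], fun g h => ?_⟩
  have := hmul (g⁻¹ * h) h⁻¹
  rw [mul_inv_cancel_right] at this
  rw [this, mul_inv_cancel_right, hlen']

theorem orbitCocycle_equivariant [Countable G]
    (hact : IsPmpAction act μ) (hact' : IsPmpAction act' ν)
    (hfree' : EssentiallyFree act' ν) {Φ : X → Y} (hΦ : Measure.QuasiMeasurePreserving Φ μ ν)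
    {σ : G → X → H} (hσ : ∀ g, ∀ᵐ x ∂μ, Φ (act g x) = act' (σ g x) (Φ x)) (g : G) :
    ∀ᵐ x ∂μ, (fun d : G => (σ d⁻¹ (act g x))⁻¹) = mapsAct g (fun d : G => (σ d⁻¹ x)⁻¹) := by
  filter_upwards [ae_all_iff.mpr fun d : G =>
    orbitCocycle_mul hact hact' hfree' hΦ hσ d⁻¹ g] with x hx
  funext d
  simp [mapsAct, hx]

end OrbitCocycles

section MapSpace

variable {G H : Type*} [Group G] [Group H] [Countable H] [MeasurableSpace H]
  [DiscreteMeasurableSpace H]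

theorem measurable_inv_mul_eval {ι : Type*} (a b : ι) : Measurable fun f : ι → H => (f a)⁻¹ * f b := by
  have hmul : Measurable fun p : H × H => p.1⁻¹ * p.2 := .of_discrete
  have heval : Measurable fun f : ι → H => (f a, f b) :=
    (measurable_pi_apply a).prodMk (measurable_pi_apply b)
  exact hmul.comp heval

theorem measurable_mapsAct_s18 (g : G) : Measurable (mapsAct g : (G → H) → G → H) :=
  measurable_pi_lambda _ fun d => measurable_inv_mul_eval g⁻¹ (g⁻¹ * d)

theorem measurableSet_isometry [Countable G] (SG : Set G) (SH : Set H) :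
    MeasurableSet {f : G → H | Function.Bijective f ∧ f 1 = 1 ∧
      ∀ a b : G, wlen SH ((f a)⁻¹ * f b) = wlen SG (a⁻¹ * b)} := by
  have heq : ∀ (a : G) (b : H), MeasurableSet {f : G → H | f a = b} := fun a b =>
    measurableSet_eq_fun (measurable_pi_apply a) measurable_const
  have hinj : MeasurableSet {f : G → H | Function.Injective f} := by
    have : {f : G → H | Function.Injective f} = ⋂ (a) (b), {f | f a = f b → a = b} := by
      ext f
      simp [Function.Injective]
    rw [this]
    exact .iInter fun a => .iInter fun b =>
      (measurableSet_eq_fun (measurable_pi_apply a) (measurable_pi_apply b)).imp (.const _)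
  have hsurj : MeasurableSet {f : G → H | Function.Surjective f} := by
    have : {f : G → H | Function.Surjective f} = ⋂ b, ⋃ a, {f | f a = b} := by
      ext f
      simp [Function.Surjective]
    rw [this]
    exact .iInter fun b => .iUnion fun a => heq a b
  have hlen : MeasurableSet {f : G → H |
      ∀ a b : G, wlen SH ((f a)⁻¹ * f b) = wlen SG (a⁻¹ * b)} := by
    have : {f : G → H | ∀ a b : G, wlen SH ((f a)⁻¹ * f b) = wlen SG (a⁻¹ * b)} =
        ⋂ (a) (b), (fun f => (f a)⁻¹ * f b) ⁻¹' {c | wlen SH c = wlen SG (a⁻¹ * b)} := by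
      ext f
      simp
    rw [this]
    exact .iInter fun a => .iInter fun b => measurable_inv_mul_eval a b .of_discrete
  exact (hinj.inter hsurj).inter ((heq 1 1).inter hlen)

end MapSpace

end IOE

/-- For a length-preserving orbit equivalence between p.m.p.
essentially free actions, the maps `σ_x` and `τ_y` obtained from the orbit equivalence
cocycles are a.e. bijective isometries between the Cayley graphs fixing the identity,
the maps `x ↦ σ_x`, `y ↦ τ_y` are equivariant, and the pushforward of `μ` by `x ↦ σ_x`
is a `Γ`-invariant probability measure on `Iso₁(Γ,Λ)`. -/
theorem stmt18
    {Γ Λ X Y : Type*} [Group Γ] [Countable Γ] [Group Λ] [Countable Λ]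
    [MeasurableSpace Λ] [DiscreteMeasurableSpace Λ]
    [MeasurableSpace Γ] [DiscreteMeasurableSpace Γ]
    [MeasurableSpace X] [StandardBorelSpace X] [MeasurableSpace Y] [StandardBorelSpace Y]
    (SΓ : Set Γ) (SΛ : Set Λ) (hSΓ : IsGenSystem SΓ) (hSΛ : IsGenSystem SΛ)
    (μ : Measure X) (ν : Measure Y) [IsProbabilityMeasure μ] [IsProbabilityMeasure ν]
    (α : Γ → X → X) (β : Λ → Y → Y)
    (hα : IsPmpAction α μ) (hβ : IsPmpAction β ν)
    (hαfree : EssentiallyFree α μ) (hβfree : EssentiallyFree β ν)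
    (Φ : X ≃ Y) (hΦ : IsOrbitEquiv α μ β ν Φ)
    (σ : Γ → X → Λ) (τ : Λ → Y → Γ)
    (hσmeas : ∀ (γ : Γ) (lam : Λ), MeasurableSet {x | σ γ x = lam})
    (hτmeas : ∀ (lam : Λ) (γ : Γ), MeasurableSet {y | τ lam y = γ})
    (hσ : ∀ γ : Γ, ∀ᵐ x ∂μ, Φ (α γ x) = β (σ γ x) (Φ x))
    (hτ : ∀ lam : Λ, ∀ᵐ y ∂ν, Φ (α (τ lam y) (Φ.symm y)) = β lam y)
    -- `Φ` is length-preserving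
    (hσlen : LengthPreservingCocycle SΓ SΛ μ σ)
    (hτlen : LengthPreservingCocycle SΛ SΓ ν τ) :
    -- `σ_x` is a.e. a bijective isometry of Cayley graphs fixing the identity
    (∀ᵐ x ∂μ, Function.Bijective (fun γ : Γ => (σ γ⁻¹ x)⁻¹) ∧
      (σ (1 : Γ)⁻¹ x)⁻¹ = (1 : Λ) ∧
      ∀ γ δ : Γ, wlen SΛ ((σ γ⁻¹ x) * (σ δ⁻¹ x)⁻¹) = wlen SΓ (γ⁻¹ * δ)) ∧
    -- `τ_y` is a.e. a bijective isometry of Cayley graphs fixing the identity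
    (∀ᵐ y ∂ν, Function.Bijective (fun lam : Λ => (τ lam⁻¹ y)⁻¹) ∧
      (τ (1 : Λ)⁻¹ y)⁻¹ = (1 : Γ) ∧
      ∀ lam e : Λ, wlen SΓ ((τ lam⁻¹ y) * (τ e⁻¹ y)⁻¹) = wlen SΛ (lam⁻¹ * e)) ∧
    -- equivariance of `x ↦ σ_x` and `y ↦ τ_y`
    (∀ γ : Γ, ∀ᵐ x ∂μ,
      (fun δ : Γ => (σ δ⁻¹ (α γ x))⁻¹) = mapsAct γ (fun δ : Γ => (σ δ⁻¹ x)⁻¹)) ∧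
    (∀ lam : Λ, ∀ᵐ y ∂ν,
      (fun e : Λ => (τ e⁻¹ (β lam y))⁻¹) = mapsAct lam (fun e : Λ => (τ e⁻¹ y)⁻¹)) ∧
    -- the pushforward of `μ` is a `Γ`-invariant probability measure concentrated on
    -- `Iso₁(Γ,Λ)`
    (IsProbabilityMeasure (μ.map (fun x (γ : Γ) => (σ γ⁻¹ x)⁻¹)) ∧
      (∀ γ : Γ, (μ.map (fun x (δ : Γ) => (σ δ⁻¹ x)⁻¹)).map (mapsAct γ)
        = μ.map (fun x (δ : Γ) => (σ δ⁻¹ x)⁻¹)) ∧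
      (μ.map (fun x (δ : Γ) => (σ δ⁻¹ x)⁻¹))
        {f : Γ → Λ | ¬ (Function.Bijective f ∧ f 1 = 1 ∧
          ∀ γ δ : Γ, wlen SΛ ((f γ)⁻¹ * f δ) = wlen SΓ (γ⁻¹ * δ))} = 0) := by
  obtain ⟨hΦm, hΦsm, hΦmp, -⟩ := hΦ
  have hΦq : Measure.QuasiMeasurePreserving Φ μ ν := hΦmp.quasiMeasurePreserving
  have hΦsq : Measure.QuasiMeasurePreserving Φ.symm ν μ :=
    (MeasurePreserving.symm (⟨Φ, hΦm, hΦsm⟩ : X ≃ᵐ Y) hΦmp).quasiMeasurePreserving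
  have hτ' : ∀ lam, ∀ᵐ y ∂ν, Φ.symm (β lam y) = α (τ lam y) (Φ.symm y) := fun lam => by
    filter_upwards [hτ lam] with y hy
    rw [← hy, Φ.symm_apply_apply]
  have hσ' : ∀ γ, ∀ᵐ x ∂μ, Φ.symm (β (σ γ x) (Φ.symm.symm x)) = α γ x := fun γ => by
    filter_upwards [hσ γ] with x hx
    rw [Φ.symm_symm, ← hx, Φ.symm_apply_apply]
  have hiso := orbitCocycle_isometry hα hβ hαfree hβfree hΦq hσ hτ hσlen
  have hequiv := orbitCocycle_equivariant hα hβ hβfree hΦq hσ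
  have hmeas : Measurable fun x (δ : Γ) => (σ δ⁻¹ x)⁻¹ :=
    measurable_pi_lambda _ fun δ => (Measurable.of_discrete (f := fun c : Λ => c⁻¹)).comp
      (measurable_to_countable' fun c => hσmeas δ⁻¹ c)
  refine ⟨hiso, orbitCocycle_isometry hβ hα hβfree hαfree hΦsq hτ' hσ' hτlen, hequiv,
    orbitCocycle_equivariant hβ hα hαfree hΦsq hτ',
    Measure.isProbabilityMeasure_map hmeas.aemeasurable, fun γ => ?_, ?_⟩
  · rw [Measure.map_map (measurable_mapsAct_s18 γ) hmeas]
    calc μ.map (mapsAct γ ∘ fun x (δ : Γ) => (σ δ⁻¹ x)⁻¹)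
        = μ.map ((fun x (δ : Γ) => (σ δ⁻¹ x)⁻¹) ∘ α γ) :=
          Measure.map_congr ((hequiv γ).mono fun x hx => hx.symm)
      _ = μ.map fun x (δ : Γ) => (σ δ⁻¹ x)⁻¹ := by
          rw [← Measure.map_map hmeas (hα.measurePreserving γ).measurable,
            (hα.measurePreserving γ).map_eq]
  · refine (ae_map_iff hmeas.aemeasurable (measurableSet_isometry SΓ SΛ)).mpr ?_
    simpa only [inv_inv] using hiso
end
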